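/- Fix L ≥ 1 and a finite-dimensional real inner product space E. For each l = 0, …, L−1 let N1_l, A_l, N2_l, M_l : E →ₗ[ℝ] E be linear maps, and let N_fn : E →ₗ[ℝ] E. Define block Jacobians T^attn_l = id + A_l ∘ N1_l and T^mlp_l = id + M_l ∘ N2_l, and the full Jacobian J = N_fn ∘ T^mlp_{L−1} ∘ T^attn_{L−1} ∘ ⋯ ∘ T^mlp_0 ∘ T^attn_0. Given a submodule 𝒰 of E, define forward subspaces UX_0 = 𝒰, UP_l = UX_l.map N1_l, UO_l = UP_l.map A_l, UZ_l = UX_l.map T^attn_l, UQ_l = UZ_l.map N2_l, UM_l = UQ_l.map M_l, UX_{l+1} = UZ_l.map T^mlp_l, and UT = UX_L.map N_fn. Given Y ∈ E, define backward directions G_{X_L} = N_fn† Y and, descending in l, G_{Z_l} = (T^mlp_l)† G_{X_{l+1}}, G_{X_l} = (T^attn_l)† G_{Z_l}; aligned components A_{Z_l} = P_{UZ_l} G_{Z_l}, A_{X_{l+1}} = P_{UX_{l+1}} G_{X_{l+1}}, A_T = P_{UT} Y, and terminal source R_T = Y − A_T. Define local sources: B^{norm1}_l = P_{UX_lᗮ}(N1_l†(P_{UP_l}(A_l†(P_{UO_l}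 A_{Z_l})))), B^{attn}_l = N1_l†(P_{UP_lᗮ}(A_l†(P_{UO_l} A_{Z_l}))), B^{res1.add}_l = N1_l†(A_l†(P_{UO_lᗮ} A_{Z_l})), B^{res1.id}_l = P_{UX_lᗮ}(A_{Z_l}); B^{norm2}_l = P_{UZ_lᗮ}(N2_l†(P_{UQ_l}(M_l†(P_{UM_l} A_{X_{l+1}})))), B^{mlp}_l = N2_l†(P_{UQ_lᗮ}(M_l†(P_{UM_l} A_{X_{l+1}}))), B^{res2.add}_l = N2_l†(M_l†(P_{UM_lᗮ} A_{X_{l+1}})), B^{res2.id}_l = P_{UZ_lᗮ}(A_{X_{l+1}}); and B_fn = P_{UX_Lᗮ}(N_fn† A_T). Define cumulative adjoint transports J←_{l,attn} = (T^attn_0)† ∘ (T^mlp_0)† ∘ ⋯ ∘ (T^attn_{l−1})† ∘ (T^mlp_{l−1})† (the identity when l = 0), J←_{l,mlp} = J←_{l,attn} ∘ (T^attn_l)†, and J←_L = J←_{L−1,mlp} ∘ (T^mlp_{L−1})†. Then the refusal-escape direction decomposes exactly into operator-level contributions: P_{𝒰ᗮ}(J† Y) = Σ_{l=0}^{L−1}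 J←_{l,attn}(B^{norm1}_l + B^{attn}_l + B^{res1.add}_l + B^{res1.id}_l) + Σ_{l=0}^{L−1} J←_{l,mlp}(B^{norm2}_l + B^{mlp}_l + B^{res2.add}_l + B^{res2.id}_l) + J←_L(B_fn) + J←_L(N_fn†(R_T)). -/

import Mathlib

open Submodule LinearMap

/-- Orthogonal projection onto a submodule, viewed as a linear map into the ambient space. -/
noncomputable def projL {E : Type*} [NormedAddCommGroup E] [InnerProductSpace ℝ E]
    [FiniteDimensional ℝ E] (S : Submodule ℝ E) : E →ₗ[ℝ] E :=
  S.subtype ∘ₗ (orthogonalProjection S).toLinearMap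

theorem projL_eq_starProjection {E : Type*} [NormedAddCommGroup E] [InnerProductSpace ℝ E]
    [FiniteDimensional ℝ E] (S : Submodule ℝ E) (x : E) : projL S x = S.starProjection x := rfl

theorem projL_mem {E : Type*} [NormedAddCommGroup E] [InnerProductSpace ℝ E]
    [FiniteDimensional ℝ E] (S : Submodule ℝ E) (x : E) : projL S x ∈ S :=
  (orthogonalProjection S x).2

theorem projL_add_perp {E : Type*} [NormedAddCommGroup E] [InnerProductSpace ℝ E]
    [FiniteDimensional ℝ E] (S : Submodule ℝ E) (x : E) : projL S x + projL Sᗮ x = x := by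
  rw [projL_eq_starProjection, projL_eq_starProjection]
  exact S.starProjection_add_starProjection_orthogonal x

theorem projL_of_mem {E : Type*} [NormedAddCommGroup E] [InnerProductSpace ℝ E]
    [FiniteDimensional ℝ E] (S : Submodule ℝ E) (x : E) (hx : x ∈ S) : projL S x = x := by
  rw [projL_eq_starProjection]
  exact Submodule.starProjection_eq_self_iff.2 hx

theorem adjoint_mem_perp {E : Type*} [NormedAddCommGroup E] [InnerProductSpace ℝ E]
    [FiniteDimensional ℝ E] (U V : Submodule ℝ E) (T : E →ₗ[ℝ] E) (hV : V = U.map T)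
    (x : E) (hx : x ∈ Vᗮ) : adjoint T x ∈ Uᗮ := by
  intro u hu
  rw [LinearMap.adjoint_inner_right]
  exact hx _ (hV ▸ Submodule.mem_map_of_mem hu)

/-- One backward step: transported residual plus newly created leakage. -/
theorem projL_step {E : Type*} [NormedAddCommGroup E] [InnerProductSpace ℝ E]
    [FiniteDimensional ℝ E] (U V : Submodule ℝ E) (T : E →ₗ[ℝ] E) (hV : V = U.map T) (g : E) :
    projL Uᗮ (adjoint T g) = projL Uᗮ (adjoint T (projL V g)) + adjoint T (projL Vᗮ g) := by
  conv_lhs => rw [← projL_add_perp V g, map_add, map_add]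
  rw [projL_of_mem _ _ (adjoint_mem_perp U V T hV _ (projL_mem _ _))]

/-- Leakage of a residual block. -/
theorem projL_block {E : Type*} [NormedAddCommGroup E] [InnerProductSpace ℝ E]
    [FiniteDimensional ℝ E] (U P O : Submodule ℝ E) (N A T : E →ₗ[ℝ] E)
    (hT : T = LinearMap.id + A ∘ₗ N) (hP : P = U.map N) (hO : O = P.map A) (a : E) :
    projL Uᗮ (adjoint T a) =
      projL Uᗮ (adjoint N (projL P (adjoint A (projL O a))))
      + adjoint N (projL Pᗮ (adjoint A (projL O a)))
      + adjoint N (adjoint A (projL Oᗮ a)) + projL Uᗮ a := by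
  have h1 : adjoint T a = a + adjoint N (adjoint A a) := by
    rw [hT, map_add, LinearMap.adjoint_comp, LinearMap.adjoint_id]
    rfl
  have h2 := projL_step P O A hO a
  have h3 := projL_step U P N hP (adjoint A a)
  have h4 := projL_step U P N hP (adjoint A (projL O a))
  have h5 : projL Uᗮ (adjoint N (adjoint A (projL Oᗮ a))) = adjoint N (adjoint A (projL Oᗮ a)) :=
    projL_of_mem _ _ (adjoint_mem_perp U P N hP _ (adjoint_mem_perp P O A hO _ (projL_mem _ _)))
  rw [h1, map_add]
  conv_lhs => rw [← projL_add_perp O a, map_add (adjoint A), map_add (adjoint N),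
    map_add (projL Uᗮ) (adjoint N _), h4, h5, projL_add_perp O a]
  abel

theorem operator_level_red_decomposition
    {E : Type*} [NormedAddCommGroup E] [InnerProductSpace ℝ E] [FiniteDimensional ℝ E]
    {L : ℕ} (hL : 1 ≤ L)
    (N1 A N2 M : ℕ → E →ₗ[ℝ] E) (Nfn : E →ₗ[ℝ] E)
    -- block Jacobians
    (Tattn Tmlp : ℕ → E →ₗ[ℝ] E)
    (hTattn : ∀ l, l < L → Tattn l = LinearMap.id + (A l) ∘ₗ (N1 l))
    (hTmlp : ∀ l, l < L → Tmlp l = LinearMap.id + (M l) ∘ₗ (N2 l))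
    -- forward composition `C l = T^mlp_{l−1} ∘ T^attn_{l−1} ∘ ⋯ ∘ T^mlp_0 ∘ T^attn_0`
    (C : ℕ → E →ₗ[ℝ] E)
    (hC0 : C 0 = LinearMap.id)
    (hC : ∀ l, l < L → C (l + 1) = (Tmlp l) ∘ₗ (Tattn l) ∘ₗ (C l))
    -- full Jacobian
    (J : E →ₗ[ℝ] E) (hJ : J = Nfn ∘ₗ C L)
    -- forward subspaces
    (𝒰 : Submodule ℝ E)
    (UX UP UO UZ UQ UM : ℕ → Submodule ℝ E)
    (hUX0 : UX 0 = 𝒰)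
    (hUP : ∀ l, l < L → UP l = (UX l).map (N1 l))
    (hUO : ∀ l, l < L → UO l = (UP l).map (A l))
    (hUZ : ∀ l, l < L → UZ l = (UX l).map (Tattn l))
    (hUQ : ∀ l, l < L → UQ l = (UZ l).map (N2 l))
    (hUM : ∀ l, l < L → UM l = (UQ l).map (M l))
    (hUXs : ∀ l, l < L → UX (l + 1) = (UZ l).map (Tmlp l))
    (UT : Submodule ℝ E) (hUT : UT = (UX L).map Nfn)
    -- backward directions
    (Y : E)
    (GX GZ : ℕ → E)
    (hGXL : GX L = adjoint Nfn Y)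
    (hGZ : ∀ l, l < L → GZ l = adjoint (Tmlp l) (GX (l + 1)))
    (hGX : ∀ l, l < L → GX l = adjoint (Tattn l) (GZ l))
    -- aligned components and terminal source
    (AZ AX : ℕ → E)
    (hAZ : ∀ l, l < L → AZ l = projL (UZ l) (GZ l))
    (hAX : ∀ l, l ≤ L → AX l = projL (UX l) (GX l))
    (AT RT : E) (hAT : AT = projL UT Y) (hRT : RT = Y - AT)
    -- local operator-level sources (attention block)
    (Bnorm1 Battn Bres1add Bres1id : ℕ → E)
    (hBnorm1 : ∀ l, l < L →
      Bnorm1 l = projL (UX l)ᗮ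
        (adjoint (N1 l) (projL (UP l) (adjoint (A l) (projL (UO l) (AZ l))))))
    (hBattn : ∀ l, l < L →
      Battn l = adjoint (N1 l) (projL (UP l)ᗮ (adjoint (A l) (projL (UO l) (AZ l)))))
    (hBres1add : ∀ l, l < L →
      Bres1add l = adjoint (N1 l) (adjoint (A l) (projL (UO l)ᗮ (AZ l))))
    (hBres1id : ∀ l, l < L → Bres1id l = projL (UX l)ᗮ (AZ l))
    -- local operator-level sources (MLP block)
    (Bnorm2 Bmlp Bres2add Bres2id : ℕ → E)
    (hBnorm2 : ∀ l, l < L →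
      Bnorm2 l = projL (UZ l)ᗮ
        (adjoint (N2 l) (projL (UQ l) (adjoint (M l) (projL (UM l) (AX (l + 1)))))))
    (hBmlp : ∀ l, l < L →
      Bmlp l = adjoint (N2 l) (projL (UQ l)ᗮ (adjoint (M l) (projL (UM l) (AX (l + 1))))))
    (hBres2add : ∀ l, l < L →
      Bres2add l = adjoint (N2 l) (adjoint (M l) (projL (UM l)ᗮ (AX (l + 1)))))
    (hBres2id : ∀ l, l < L → Bres2id l = projL (UZ l)ᗮ (AX (l + 1)))
    -- final-normalization leakage source
    (Bfn : E) (hBfn : Bfn = projL (UX L)ᗮ (adjoint Nfn AT))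
    -- cumulative adjoint transports
    (Jattn Jmlp : ℕ → E →ₗ[ℝ] E)
    (hJattn0 : Jattn 0 = LinearMap.id)
    (hJattnS : ∀ l, l < L →
      Jattn (l + 1) = (Jattn l) ∘ₗ (adjoint (Tattn l)) ∘ₗ (adjoint (Tmlp l)))
    (hJmlp : ∀ l, l < L → Jmlp l = (Jattn l) ∘ₗ adjoint (Tattn l))
    (JL : E →ₗ[ℝ] E) (hJL : JL = (Jmlp (L - 1)) ∘ₗ adjoint (Tmlp (L - 1))) :
    projL 𝒰ᗮ (adjoint J Y) =
      (∑ l ∈ Finset.range L,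
        Jattn l (Bnorm1 l + Battn l + Bres1add l + Bres1id l))
      + (∑ l ∈ Finset.range L,
        Jmlp l (Bnorm2 l + Bmlp l + Bres2add l + Bres2id l))
      + JL Bfn + JL (adjoint Nfn RT) := by
  have hRJ : adjoint J Y = GX 0 := by
    have h : ∀ k, k ≤ L → adjoint (C k) (GX k) = GX 0 := by
      intro k
      induction k with
      | zero => intro _; rw [hC0, LinearMap.adjoint_id]; rfl
      | succ k ih =>
        intro hk
        have hk' : k < L := hk
        rw [← ih hk'.le, hC k hk', hGX k hk', hGZ k hk', LinearMap.adjoint_comp,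
          LinearMap.adjoint_comp]
        rfl
    rw [← h L le_rfl, hJ, hGXL, LinearMap.adjoint_comp]
    rfl
  have hJLe : JL = Jattn L := by
    obtain ⟨n, rfl⟩ : ∃ n, L = n + 1 := ⟨L - 1, by omega⟩
    rw [hJL, hJattnS n (by omega), Nat.add_sub_cancel, hJmlp n (by omega)]
    rfl
  have main : ∀ k, k ≤ L → projL 𝒰ᗮ (GX 0) =
      (∑ l ∈ Finset.range k, Jattn l (Bnorm1 l + Battn l + Bres1add l + Bres1id l))
      + (∑ l ∈ Finset.range k, Jmlp l (Bnorm2 l + Bmlp l + Bres2add l + Bres2id l))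
      + Jattn k (projL (UX k)ᗮ (GX k)) := by
    intro k
    induction k with
    | zero => intro _; simp [hJattn0, hUX0]
    | succ k ih =>
      intro hk
      have hk' : k < L := hk
      have e1 : projL (UX k)ᗮ (GX k) = (Bnorm1 k + Battn k + Bres1add k + Bres1id k)
          + adjoint (Tattn k) (projL (UZ k)ᗮ (GZ k)) := by
        rw [hGX k hk', projL_step _ _ _ (hUZ k hk') (GZ k), ← hAZ k hk',
          projL_block _ _ _ _ _ _ (hTattn k hk') (hUP k hk') (hUO k hk') (AZ k),
          ← hBnorm1 k hk', ← hBattn k hk', ← hBres1add k hk', ← hBres1id k hk']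
      have e2 : projL (UZ k)ᗮ (GZ k) = (Bnorm2 k + Bmlp k + Bres2add k + Bres2id k)
          + adjoint (Tmlp k) (projL (UX (k + 1))ᗮ (GX (k + 1))) := by
        rw [hGZ k hk', projL_step _ _ _ (hUXs k hk') (GX (k + 1)), ← hAX (k + 1) hk,
          projL_block _ _ _ _ _ _ (hTmlp k hk') (hUQ k hk') (hUM k hk') (AX (k + 1)),
          ← hBnorm2 k hk', ← hBmlp k hk', ← hBres2add k hk', ← hBres2id k hk']
      rw [ih hk'.le, e1, e2, Finset.sum_range_succ, Finset.sum_range_succ, hJattnS k hk',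
        hJmlp k hk', map_add (Jattn k) (Bnorm1 k + Battn k + Bres1add k + Bres1id k),
        map_add (adjoint (Tattn k)) (Bnorm2 k + Bmlp k + Bres2add k + Bres2id k),
        map_add (Jattn k) (adjoint (Tattn k) _)]
      simp only [LinearMap.comp_apply]
      abel
  have hRT' : RT = projL UTᗮ Y := by
    rw [hRT, hAT, sub_eq_iff_eq_add, add_comm, projL_add_perp]
  rw [hRJ, main L le_rfl, hGXL, projL_step _ _ _ hUT Y, ← hAT, ← hBfn, ← hRT', hJLe, map_add,
    add_assoc _ (Jattn L Bfn)]
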